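/- arXiv:0811.1395 — 2 statements merged into one kernel-verified Lean document; each statement's English description precedes it below -/
import Mathlib

section
/- Let I be a C*-algebra of stable rank one, let A be a unital C*-algebra containing I as a closed two-sided ideal, and let B = A/I be the quotient C*-algebra. Then A is extremally rich if and only if B is extremally rich and every extremal partial isometry in B lifts to an extremal partial isometry in A. -/
/-- A unital C*-algebra `A` is *extremally rich* if the set
`A⁻¹ 𝓔(A) A⁻¹ = {x * u * y : x, y invertible, u an extreme point of the closed unit ball}`
is dense in `A`. -/
def ExtremallyRich (A : Type*) [CStarAlgebra A] : Prop :=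
  Dense {a : A | ∃ x u y : A, IsUnit x ∧ IsUnit y ∧
    u ∈ Set.extremePoints ℝ (Metric.closedBall (0 : A) 1) ∧ a = x * u * y}

section ExtremePointsUnitBall

variable {A : Type*} [CStarAlgebra A]

theorem norm_le_one_iff_star_mul_self_le_one [PartialOrder A] [StarOrderedRing A] (a : A) :
    ‖a‖ ≤ 1 ↔ star a * a ≤ 1 := by
  rw [← CStarAlgebra.norm_le_one_iff_of_nonneg (star a * a) (star_mul_self_nonneg a),
    CStarRing.norm_star_mul_self, ← sq, sq_le_one_iff₀ (norm_nonneg a)]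

theorem eq_zero_of_mem_extremePoints_closedBall {E : Type*} [NormedAddCommGroup E]
    [NormedSpace ℝ E] {u y : E} (hu : u ∈ Set.extremePoints ℝ (Metric.closedBall (0 : E) 1))
    (hadd : ‖u + y‖ ≤ 1) (hsub : ‖u - y‖ ≤ 1) : y = 0 := by
  have h := (mem_extremePoints_iff_left.mp hu).2 (u + y) (by simpa using hadd) (u - y)
    (by simpa using hsub) ⟨1 / 2, 1 / 2, by norm_num, by norm_num, by norm_num, by module⟩
  simpa using h

theorem mul_star_mul_self_of_mul_mul_eq_zero {u : A}
    (hu : ∀ x, (1 - u * star u) * x * (1 - star u * u) = 0) : u * star u * u = u := by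
  have hz : u * (1 - star u * u) * (1 - star u * u) = 0 := by
    rw [← hu u]; noncomm_ring
  have hstar : star (u * (1 - star u * u)) * (u * (1 - star u * u)) = 0 := by
    calc _ = star u * (u * (1 - star u * u) * (1 - star u * u)) := by
          simp only [star_mul, star_sub, star_one, star_star]; noncomm_ring
      _ = 0 := by rw [hz, mul_zero]
  rw [CStarRing.star_mul_self_eq_zero_iff, mul_sub, mul_one, sub_eq_zero, ← mul_assoc] at hstar
  exact hstar.symm

theorem norm_le_one_of_mul_star_mul_self {u : A} (hu : u * star u * u = u) : ‖u‖ ≤ 1 := by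
  have h : ‖star u * u‖ * ‖star u * u‖ = ‖star u * u‖ := by
    have h1 := CStarRing.norm_star_mul_self (x := star u * u)
    rw [star_mul, star_star, show star u * u * (star u * u) = star u * (u * star u * u) by
      noncomm_ring, hu] at h1
    exact h1.symm
  rw [CStarRing.norm_star_mul_self] at h
  by_contra! hlt
  have h2 : 1 < ‖u‖ * ‖u‖ := by nlinarith
  nlinarith

theorem mem_extremePoints_closedBall_iff_mul_mul_eq_zero {u : A} :
    u ∈ Set.extremePoints ℝ (Metric.closedBall (0 : A) 1) ↔
      ∀ x, (1 - u * star u) * x * (1 - star u * u) = 0 := by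
  let _ := CStarAlgebra.spectralOrder A
  have _ := CStarAlgebra.spectralOrderedRing A
  constructor
  · intro hu
    have hnorm : ‖u‖ ≤ 1 := by simpa using hu.1
    have hle := (norm_le_one_iff_star_mul_self_le_one u).mp hnorm
    have hpi : u * star u * u = u := by
      have hadd : ‖u * (3 - star u * u)‖ ≤ 2 := by
        have h4 : star (u * (3 - star u * u)) * (u * (3 - star u * u)) ≤ (4 : ℕ) := by
          rw [← sub_nonneg]
          have hpos : 0 ≤ 4 - star u * u := by
            have : (0 : A) ≤ 1 - star u * u := sub_nonneg.mpr hle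
            have h1 : (0 : A) ≤ 1 := zero_le_one
            calc (0 : A) ≤ (1 - star u * u) + (1 + 1 + 1) :=
                  add_nonneg this (add_nonneg (add_nonneg h1 h1) h1)
              _ = _ := by rw [show (4 : A) = 1 + (1 + 1 + 1) by norm_num]; abel
          have hconj := star_left_conjugate_nonneg hpos (1 - star u * u)
          have h3 : star (3 : A) = 3 := star_ofNat 3
          simp only [star_mul, star_sub, star_one, star_star, h3] at hconj ⊢
          convert hconj using 1
          rw [Nat.cast_ofNat, show (3 : A) = 1 + 1 + 1 by norm_num,
            show (4 : A) = 1 + 1 + 1 + 1 by norm_num]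
          noncomm_ring
        rw [← CStarAlgebra.norm_le_natCast_iff_of_nonneg _ 4 (star_mul_self_nonneg _),
          CStarRing.norm_star_mul_self] at h4
        push_cast at h4
        nlinarith
      have hsub : ‖u * (1 + star u * u)‖ ≤ 2 := by
        have : ‖u * (star u * u)‖ ≤ 1 := by
          grw [norm_mul_le, CStarRing.norm_star_mul_self]
          nlinarith [norm_nonneg u]
        rw [mul_add, mul_one]
        grw [norm_add_le, this, hnorm]; norm_num
      have h := eq_zero_of_mem_extremePoints_closedBall (y := (1 / 2 : ℝ) • (u * (1 - star u * u)))
        hu ?_ ?_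
      · have h0 : u * (1 - star u * u) = 0 := by simpa using h
        rw [mul_sub, mul_one, sub_eq_zero, ← mul_assoc] at h0
        exact h0.symm
      · have : u + (1 / 2 : ℝ) • (u * (1 - star u * u)) = (1 / 2 : ℝ) • (u * (3 - star u * u)) := by
          rw [show (3 : A) = 1 + 1 + 1 by norm_num]
          simp only [mul_sub, mul_add, mul_one]
          module
        rw [this, norm_smul]
        norm_num
        linarith
      · have : u - (1 / 2 : ℝ) • (u * (1 - star u * u)) = (1 / 2 : ℝ) • (u * (1 + star u * u)) := by
          simp only [mul_sub, mul_add, mul_one]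
          module
        rw [this, norm_smul]
        norm_num
        linarith
    have hbound (y : A) (hy : ‖y‖ ≤ 1) (hl : star u * y = 0) (hr : y * (1 - star u * u) = y) :
        ‖u + y‖ ≤ 1 := by
      rw [norm_le_one_iff_star_mul_self_le_one] at hy ⊢
      have hl' : star y * u = 0 := by simpa using congrArg star hl
      have hr' : (1 - star u * u) * star y = star y := by simpa using congrArg star hr
      have hconj := star_left_conjugate_le_conjugate hy (1 - star u * u)
      have hrr : star (1 - star u * u) * 1 * (1 - star u * u) = 1 - star u * u := by
        simp only [star_sub, star_mul, star_one, star_star, mul_one]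
        calc _ = 1 - star u * u - star u * u + star u * (u * star u * u) := by noncomm_ring
          _ = _ := by rw [hpi]; abel
      rw [hrr] at hconj
      have hyy : star (1 - star u * u) * (star y * y) * (1 - star u * u) = star y * y := by
        simp only [star_sub, star_mul, star_one, star_star]
        rw [← mul_assoc, hr', mul_assoc, hr]
      rw [hyy] at hconj
      calc star (u + y) * (u + y) = star u * u + star y * y + (star u * y + star y * u) := by
            rw [star_add]; noncomm_ring
        _ = star u * u + star y * y := by rw [hl, hl', add_zero, add_zero]
        _ ≤ star u * u + (1 - star u * u) := by gcongr
        _ = 1 := by abel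
    intro x
    set z := (1 - u * star u) * x * (1 - star u * u) with hz
    have hl : star u * z = 0 := by
      calc star u * z = star (u - u * star u * u) * x * (1 - star u * u) := by
            rw [hz]; simp only [star_sub, star_mul, star_star]; noncomm_ring
        _ = 0 := by rw [hpi]; simp
    have hr : z * (1 - star u * u) = z := by
      calc z * (1 - star u * u)
          = z - (1 - u * star u) * x * (star u * u - star u * (u * star u * u)) := by
            rw [hz]; noncomm_ring
        _ = z := by rw [hpi]; simp
    set t : ℝ := (‖z‖ + 1)⁻¹
    have ht : 0 < t := by positivity
    have htz : ‖t • z‖ ≤ 1 := by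
      rw [norm_smul, Real.norm_of_nonneg ht.le, inv_mul_le_iff₀ (by positivity)]
      linarith
    have h0 := eq_zero_of_mem_extremePoints_closedBall (y := t • z) hu
      (hbound _ htz (by simp [hl]) (by simp [hr]))
      (by rw [sub_eq_add_neg]; exact hbound _ (by simpa using htz) (by simp [hl]) (by simp [hr]))
    simpa [ht.ne'] using h0
  · intro hu
    have hpi := mul_star_mul_self_of_mul_mul_eq_zero hu
    rw [mem_extremePoints_iff_left]
    refine ⟨by simpa using norm_le_one_of_mul_star_mul_self hpi, ?_⟩
    -- the difference `d` of the endpoints satisfies `(t * s) • (d⋆ * d) ≤ 1 - u⋆ * u`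
    have key (w a b : A) (hw : w * star w * w = w) (ha : ‖a‖ ≤ 1) (hb : ‖b‖ ≤ 1) (t s : ℝ)
        (ht : 0 < t) (hs : 0 < s) (hts : t + s = 1) (hab : t • a + s • b = w) :
        (a - b) * (star w * w) = 0 := by
      rw [norm_le_one_iff_star_mul_self_le_one] at ha hb
      set d := a - b
      obtain rfl : t = 1 - s := by linarith
      have hle : ((1 - s) * s) • (star d * d) ≤ 1 - star w * w := by
        rw [le_sub_iff_add_le]
        calc ((1 - s) * s) • (star d * d) + star w * w
            = (1 - s) • (star a * a) + s • (star b * b) := by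
              rw [← hab]
              simp only [d, star_add, star_sub, star_smul, star_trivial, add_mul, mul_add, sub_mul,
                mul_sub, smul_mul_assoc, mul_smul_comm]
              module
          _ ≤ (1 - s) • 1 + s • 1 := by gcongr
          _ = 1 := by module
      have hconj := star_left_conjugate_le_conjugate hle (star w * w)
      have hzero : star (star w * w) * (1 - star w * w) * (star w * w) = 0 := by
        simp only [star_mul, star_star]
        calc _ = star w * (w * star w * w) - star w * (w * star w * w) * (star w * w) := by
              noncomm_ring
          _ = 0 := by rw [hw, mul_assoc, ← mul_assoc w, hw, sub_self]
      rw [hzero] at hconj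
      have hle' : star (d * (star w * w)) * (d * (star w * w)) ≤ 0 := by
        have hpos : 0 < (1 - s) * s := mul_pos ht hs
        have : ((1 - s) * s) • (star (d * (star w * w)) * (d * (star w * w))) ≤ 0 := by
          convert hconj using 1
          simp only [star_mul, star_star, smul_mul_assoc, mul_smul_comm, mul_assoc]
        have h2 := smul_le_smul_of_nonneg_left this (inv_nonneg.mpr hpos.le)
        rwa [smul_smul, inv_mul_cancel₀ hpos.ne', one_smul, smul_zero] at h2
      exact (CStarRing.star_mul_self_eq_zero_iff _).mp
        (le_antisymm hle' (star_mul_self_nonneg _))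
    intro a ha b hb ⟨t, s, ht, hs, hts, hab⟩
    simp only [Metric.mem_closedBall, dist_zero_right] at ha hb
    have h1 := key u a b hpi ha hb t s ht hs hts hab
    have h2 := key (star u) (star a) (star b)
      (by simpa [mul_assoc] using congrArg star hpi) (by simpa) (by simpa) t s ht hs hts
      (by simpa using congrArg star hab)
    have h3 : (u * star u) * (a - b) = 0 := by simpa using congrArg star h2
    have h4 : a - b = 0 := by
      calc a - b = (a - b) - (a - b) * (star u * u)
            - (u * star u * (a - b)) * (1 - star u * u) := by rw [h1, h3]; simp
        _ = (1 - u * star u) * (a - b) * (1 - star u * u) := by noncomm_ring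
        _ = 0 := hu _
    rw [sub_eq_zero] at h4
    rw [← hab, h4, ← add_smul, hts, one_smul]

end ExtremePointsUnitBall

section ExtremallyRichLifting

open CStarAlgebra

variable {A B : Type*} [CStarAlgebra A] [CStarAlgebra B]

theorem mem_extremePoints_closedBall_of_isUnit_mul_mul {x v y : A} (hx : IsUnit x) (hy : IsUnit y)
    (hv : v ∈ Set.extremePoints ℝ (Metric.closedBall (0 : A) 1))
    (hw : (x * v * y) * star (x * v * y) * (x * v * y) = x * v * y) :
    x * v * y ∈ Set.extremePoints ℝ (Metric.closedBall (0 : A) 1) := by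
  rw [mem_extremePoints_closedBall_iff_mul_mul_eq_zero] at hv ⊢
  set w := x * v * y with hwdef
  have hr : v * (y * (1 - star w * w)) = 0 := by
    rw [← hx.mul_right_inj, mul_zero]
    calc x * (v * (y * (1 - star w * w))) = w - w * star w * w := by
          rw [hwdef]; noncomm_ring
      _ = 0 := by rw [hw, sub_self]
  have hl : ((1 - w * star w) * x) * v = 0 := by
    rw [← hy.mul_left_inj, zero_mul]
    calc (1 - w * star w) * x * v * y = w - w * star w * w := by
          rw [hwdef]; noncomm_ring
      _ = 0 := by rw [hw, sub_self]
  intro z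
  obtain ⟨x, rfl⟩ := hx
  obtain ⟨y, rfl⟩ := hy
  set p := 1 - w * star w
  set r := 1 - star w * w
  calc p * z * r = p * x * (↑x⁻¹ * z * ↑y⁻¹) * (y * r) := by
        simp [mul_assoc]
    _ = (p * x) * ((1 - v * star v) * (↑x⁻¹ * z * ↑y⁻¹) * (1 - star v * v)) * (y * r)
        + (p * x * v) * star v * (↑x⁻¹ * z * ↑y⁻¹) * (1 - star v * v) * (y * r)
        + (p * x) * (↑x⁻¹ * z * ↑y⁻¹) * star v * (v * (y * r)) := by noncomm_ring
    _ = 0 := by rw [hv, hl, hr]; simp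

theorem exists_forall_mem_spectrum_star_mul_self {a b : A} (hab : a * b * a = a) :
    ∃ δ : ℝ, 0 < δ ∧ δ ≤ 1 ∧ ∀ t ∈ spectrum ℝ (star a * a), t = 0 ∨ δ ≤ t := by
  let _ := spectralOrder A
  have _ := spectralOrderedRing A
  set h := star a * a with hh
  have hsa : IsSelfAdjoint h := .star_mul_self a
  set C : ℝ := ‖b‖ ^ 2 + 1
  have hC : 1 ≤ C := by simp only [C]; nlinarith [sq_nonneg ‖b‖]
  have hC0 : 0 < C := by linarith
  have hle : h ^ 2 ≤ C • h ^ 3 := by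
    have hbb : b * star b ≤ C • (1 : A) := by
      refine mul_star_le_algebraMap_norm_sq.trans ?_
      rw [Algebra.algebraMap_eq_smul_one]
      have h1 : (0 : A) ≤ 1 := zero_le_one
      exact smul_le_smul_of_nonneg_right (by simp [C]) h1
    have hconj := star_left_conjugate_le_conjugate hbb h
    have hpos := star_mul_self_nonneg (star b * h - C • (a * h))
    have e1 : h * b * a = h := by rw [hh, mul_assoc, mul_assoc, ← mul_assoc a, hab]
    have e2 : star a * star b * h = h := by
      simpa [hsa.star_eq, mul_assoc] using congrArg star e1
    have e3 : star (star b * h - C • (a * h)) * (star b * h - C • (a * h))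
        = h * (b * star b) * h - (2 * C) • h ^ 2 + (C * C) • h ^ 3 := by
      calc _ = h * (b * star b) * h - C • ((h * b * a) * h) - C • (h * (star a * star b * h))
            + (C * C) • (h * (star a * a) * h) := by
            simp only [star_sub, star_mul, star_star, star_smul, star_trivial, hsa.star_eq,
              sub_mul, mul_sub, smul_mul_assoc, mul_smul_comm, mul_assoc, smul_sub, smul_smul]
            abel
        _ = _ := by
            rw [e1, e2, ← hh, pow_three', ← sq]
            module
    rw [e3] at hpos
    rw [hsa.star_eq] at hconj
    have h4 : 0 ≤ C • (C • h ^ 3 - h ^ 2) := by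
      calc 0 ≤ h * (b * star b) * h - (2 * C) • h ^ 2 + (C * C) • h ^ 3 := hpos
        _ ≤ h * (C • 1) * h - (2 * C) • h ^ 2 + (C * C) • h ^ 3 := by gcongr
        _ = C • (C • h ^ 3 - h ^ 2) := by
          rw [mul_smul_comm, mul_one, smul_mul_assoc, ← sq]
          module
    have h5 := smul_le_smul_of_nonneg_left h4 (inv_nonneg.mpr hC0.le)
    rwa [smul_zero, smul_smul, inv_mul_cancel₀ hC0.ne', one_smul, sub_nonneg] at h5
  rw [← cfc_pow_id (R := ℝ) h 2, ← cfc_pow_id (R := ℝ) h 3, ← cfc_smul C (fun x : ℝ => x ^ 3) h,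
    cfc_le_iff _ _ h] at hle
  refine ⟨C⁻¹, inv_pos.mpr hC0, inv_le_one_of_one_le₀ hC, fun t ht => ?_⟩
  have ht2 := hle t ht
  by_cases ht0 : t = 0
  · exact .inl ht0
  right
  simp only [smul_eq_mul] at ht2
  rw [inv_le_iff_one_le_mul₀ hC0]
  have : 0 < t ^ 2 := by positivity
  nlinarith

theorem exists_mem_extremePoints_closedBall_of_map_isUnit_mul_mul (q : A →⋆ₐ[ℂ] B) {x v y : A}
    {u : B} (hx : IsUnit x) (hy : IsUnit y)
    (hv : v ∈ Set.extremePoints ℝ (Metric.closedBall (0 : A) 1))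
    (hu : u * star u * u = u) (hq : q (x * v * y) = u) :
    ∃ w ∈ Set.extremePoints ℝ (Metric.closedBall (0 : A) 1), q w = u := by
  have hvv := mul_star_mul_self_of_mul_mul_eq_zero
    (mem_extremePoints_closedBall_iff_mul_mul_eq_zero.mp hv)
  set a := x * v * y with ha
  obtain ⟨δ, hδ0, hδ1, hδ⟩ := exists_forall_mem_spectrum_star_mul_self (a := a)
    (b := ↑hy.unit⁻¹ * star v * ↑hx.unit⁻¹) (by
      calc a * (↑hy.unit⁻¹ * star v * ↑hx.unit⁻¹) * a
          = x * (v * (y * ↑hy.unit⁻¹) * star v * (↑hx.unit⁻¹ * x) * v) * y := by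
            rw [ha]; noncomm_ring
        _ = a := by rw [hy.mul_val_inv, hx.val_inv_mul, mul_one, mul_one, hvv])
  set h := star a * a with hh
  have hsa : IsSelfAdjoint h := .star_mul_self a
  set g : ℝ → ℝ := fun t => (√(max t δ))⁻¹
  have hpos (t : ℝ) : 0 < √(max t δ) := Real.sqrt_pos.mpr (lt_max_of_lt_right hδ0)
  have hg : Continuous g := by
    refine Continuous.inv₀ (by fun_prop) fun t => (hpos t).ne'
  set G := cfc g h
  have hGsa : star G = G := (cfc_predicate g h : IsSelfAdjoint _).star_eq
  have hGu : IsUnit G := (isUnit_cfc_iff g h hg.continuousOn).mpr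
    fun t _ => (inv_pos.mpr (hpos t)).ne'
  have he : star (a * G) * (a * G) = cfc (fun t => g t * t * g t) h := by
    rw [cfc_mul _ _ h (by fun_prop) (by fun_prop), cfc_mul _ _ h (by fun_prop) (by fun_prop),
      cfc_id' ℝ h, star_mul, hGsa, hh]
    noncomm_ring
  have hee : star (a * G) * (a * G) * (star (a * G) * (a * G)) = star (a * G) * (a * G) := by
    rw [he, ← cfc_mul _ _ h (by fun_prop) (by fun_prop)]
    refine cfc_congr fun t ht => ?_
    rcases hδ t ht with rfl | hle
    · simp
    · have hgt : g t * t * g t = 1 := by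
        have ht0 : 0 < t := hδ0.trans_le hle
        simp only [g, max_eq_left hle]
        field_simp
        rw [Real.sq_sqrt ht0.le]
      simp [hgt]
  have hw : (a * G) * star (a * G) * (a * G) = a * G := by
    set w := a * G
    have : star (w * star w * w - w) * (w * star w * w - w) = 0 := by
      calc _ = (star w * w * (star w * w)) * (star w * w) - (star w * w * (star w * w))
            - (star w * w * (star w * w)) + star w * w := by
            simp only [star_sub, star_mul, star_star]; noncomm_ring
        _ = 0 := by rw [hee, hee]; abel
    rwa [CStarRing.star_mul_self_eq_zero_iff, sub_eq_zero] at this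
  refine ⟨a * G, ?_, ?_⟩
  · rw [ha, mul_assoc (x * v)] at hw ⊢
    exact mem_extremePoints_closedBall_of_isUnit_mul_mul hx (hy.mul hGu) hv hw
  · set k := star u * u with hk
    have hksa : IsSelfAdjoint k := .star_mul_self u
    have hkk : k * k = k := by rw [hk, mul_assoc, ← mul_assoc u, hu]
    have huk : u * k = u := by rw [hk, ← mul_assoc, hu]
    have hspec : ∀ t ∈ spectrum ℝ k, t = 0 ∨ t = 1 := by
      intro t ht
      have := IsIdempotentElem.spectrum_subset ℝ (show IsIdempotentElem k from hkk) ht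
      simpa using this
    have hkg : k * cfc g k = k := by
      calc k * cfc g k = cfc (fun t => t * g t) k := by
            rw [cfc_mul _ _ k (by fun_prop) (by fun_prop), cfc_id' ℝ k]
        _ = cfc (fun t => t) k := by
            refine cfc_congr fun t ht => ?_
            rcases hspec t ht with rfl | rfl
            · simp
            · simp [g, max_eq_left hδ1]
        _ = k := cfc_id' ℝ k
    have hqh : q h = k := by rw [hh, map_mul, map_star, hq]
    have hqG : q G = cfc g k := by
      rw [← hqh]
      exact q.map_cfc g h (hg.continuousOn) (by fun_prop) hsa (by rw [hqh]; exact hksa)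
    rw [map_mul, hq, hqG, ← huk, mul_assoc, hkg]

theorem exists_isUnit_map_eq_exp (q : A →⋆ₐ[ℂ] B) (hq : Function.Surjective q) (d : B) :
    ∃ k : A, IsUnit k ∧ q k = NormedSpace.exp d := by
  let _ : NormedAlgebra ℚ A := NormedAlgebra.restrictScalars ℚ ℂ A
  let _ : NormedAlgebra ℚ B := NormedAlgebra.restrictScalars ℚ ℂ B
  obtain ⟨D, rfl⟩ := hq d
  exact ⟨NormedSpace.exp D, NormedSpace.isUnit_exp D, NormedSpace.map_exp q (by fun_prop) D⟩

theorem exists_isUnit_map_eq_one_add (q : A →⋆ₐ[ℂ] B) (hq : Function.Surjective q) {d : B}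
    (hd : d * d = 0) : ∃ k : A, IsUnit k ∧ q k = 1 + d := by
  obtain ⟨k, hk, hqk⟩ := exists_isUnit_map_eq_exp q hq d
  refine ⟨k, hk, hqk.trans ?_⟩
  rw [NormedSpace.exp_eq_tsum ℂ]
  beta_reduce
  rw [tsum_eq_sum (s := Finset.range 2)]
  · simp [Finset.sum_range_succ]
  · intro n hn
    obtain ⟨m, rfl⟩ : ∃ m, n = m + 2 := ⟨n - 2, by simp at hn; omega⟩
    simp [pow_add, sq, hd]

theorem exists_isUnit_map_mul_unitary (q : A →⋆ₐ[ℂ] B) (hq : Function.Surjective q) {x : B}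
    (hx : IsUnit x) : ∃ k : A, IsUnit k ∧ ∃ s ∈ unitary B, x = q k * s := by
  let _ := spectralOrder B
  have _ := spectralOrderedRing B
  have hxx : IsStrictlyPositive (x * star x) :=
    IsStrictlyPositive.iff_of_unital.mpr ⟨mul_star_self_nonneg x, hx.mul hx.star⟩
  set p := CFC.sqrt (x * star x)
  have hp : IsStrictlyPositive p := hxx.sqrt
  have hpp : p * p = x * star x := CFC.sqrt_mul_sqrt_self _
  obtain ⟨k, hk, hqk⟩ := exists_isUnit_map_eq_exp q hq (CFC.log p)
  rw [CFC.exp_log p hp] at hqk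
  have hpsa : star p = p := hp.nonneg.isSelfAdjoint.star_eq
  obtain ⟨P, hP⟩ := hp.isUnit
  have hPsa : star (↑P⁻¹ : B) = ↑P⁻¹ := by
    rw [← Units.coe_star_inv]
    congr 2
    ext
    rw [Units.coe_star, hP, hpsa]
  have hs : (↑P⁻¹ * x) * star (↑P⁻¹ * x) = 1 := by
    calc (↑P⁻¹ * x) * star (↑P⁻¹ * x) = ↑P⁻¹ * (x * star x) * ↑P⁻¹ := by
          rw [star_mul, hPsa]; noncomm_ring
      _ = 1 := by rw [← hpp, ← hP]; simp
  have hsu : IsUnit (↑P⁻¹ * x) := P⁻¹.isUnit.mul hx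
  refine ⟨k, hk, ↑P⁻¹ * x, ?_, by rw [hqk, ← hP, Units.mul_inv_cancel_left]⟩
  refine Unitary.mem_iff.mpr ⟨?_, hs⟩
  rw [← hsu.mul_right_inj, ← mul_assoc, hs, one_mul, mul_one]

theorem unitary_mul_mul_mem_extremePoints_closedBall {s u t : A} (hs : s ∈ unitary A)
    (ht : t ∈ unitary A) (hu : u ∈ Set.extremePoints ℝ (Metric.closedBall (0 : A) 1)) :
    s * u * t ∈ Set.extremePoints ℝ (Metric.closedBall (0 : A) 1) := by
  have hpi := mul_star_mul_self_of_mul_mul_eq_zero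
    (mem_extremePoints_closedBall_iff_mul_mul_eq_zero.mp hu)
  refine mem_extremePoints_closedBall_of_isUnit_mul_mul
    (Unitary.toUnits ⟨s, hs⟩).isUnit (Unitary.toUnits ⟨t, ht⟩).isUnit hu ?_
  calc (s * u * t) * star (s * u * t) * (s * u * t)
      = s * (u * (t * star t) * star u * (star s * s) * u) * t := by
        simp only [star_mul]; noncomm_ring
    _ = s * u * t := by
        rw [Unitary.mul_star_self_of_mem ht, Unitary.star_mul_self_of_mem hs, mul_one, mul_one, hpi]

/-- A perturbation `u + c` of an extremal partial isometry, with `1 + u⋆ * c` replaced by a unit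
`g`, is a unit `1 + d` with `d * d = 0`, times `u`, times `g`. -/
theorem exists_mul_self_eq_zero_mul_add {u : A}
    (hu : u ∈ Set.extremePoints ℝ (Metric.closedBall (0 : A) 1)) (c : A) {g : A} (hg : IsUnit g) :
    ∃ d : A, d * d = 0 ∧ u * g + (1 - u * star u) * c = (1 + d) * u * g := by
  rw [mem_extremePoints_closedBall_iff_mul_mul_eq_zero] at hu
  have hpi := mul_star_mul_self_of_mul_mul_eq_zero hu
  have hpi' : star u * (1 - u * star u) = 0 := by
    have : star u * u * star u = star u := by simpa [mul_assoc] using congrArg star hpi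
    rw [mul_sub, mul_one, ← mul_assoc, this, sub_self]
  obtain ⟨g, rfl⟩ := hg
  refine ⟨(1 - u * star u) * c * ↑g⁻¹ * star u, ?_, ?_⟩
  · calc _ = (1 - u * star u) * c * ↑g⁻¹ * (star u * (1 - u * star u)) * c * ↑g⁻¹ * star u := by
          noncomm_ring
      _ = 0 := by rw [hpi']; simp
  · have h := hu (c * ↑g⁻¹)
    rw [mul_sub, mul_one, sub_eq_zero] at h
    calc u * g + (1 - u * star u) * c = u * g + (1 - u * star u) * (c * ↑g⁻¹) * g := by
          simp [mul_assoc]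
      _ = _ := by rw [h]; noncomm_ring

theorem ExtremallyRich.of_surjective (q : A →⋆ₐ[ℂ] B) (hq : Function.Surjective q)
    (hA : ExtremallyRich A) : ExtremallyRich B := by
  refine (hq.denseRange.dense_image (by fun_prop) hA).mono ?_
  rintro _ ⟨_, ⟨x, u, y, hx, hy, hu, rfl⟩, rfl⟩
  refine ⟨q x, q u, q y, hx.map q, hy.map q, ?_, by simp⟩
  rw [mem_extremePoints_closedBall_iff_mul_mul_eq_zero] at hu ⊢
  intro z
  obtain ⟨z, rfl⟩ := hq z
  simpa only [map_mul, map_sub, map_one, map_star, map_zero] using congrArg q (hu z)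

theorem ExtremallyRich.exists_mem_extremePoints_closedBall_map_eq (q : A →⋆ₐ[ℂ] B)
    (hq : Function.Surjective q) (hA : ExtremallyRich A) {u : B}
    (hu : u ∈ Set.extremePoints ℝ (Metric.closedBall (0 : B) 1)) :
    ∃ v ∈ Set.extremePoints ℝ (Metric.closedBall (0 : A) 1), q v = u := by
  obtain ⟨a₀, rfl⟩ := hq u
  have hopen : IsOpen {a : A | IsUnit (1 + star a₀ * (a - a₀))} :=
    Units.isOpen.preimage (f := fun a => 1 + star a₀ * (a - a₀)) (by fun_prop)
  obtain ⟨_, hG, x, v, y, hx, hy, hv, rfl⟩ := hA.inter_open_nonempty _ hopen ⟨a₀, by simp⟩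
  simp only [Set.mem_ofPred_eq] at hG
  set a := x * v * y with ha
  set G := 1 + star a₀ * (a - a₀)
  obtain ⟨d, hd, hdg⟩ := exists_mul_self_eq_zero_mul_add hu (q a - q a₀) (hG.map q)
  obtain ⟨S, hS, hqS⟩ := exists_isUnit_map_eq_one_add q hq hd
  have hqa : q a = q S * q a₀ * q G := by
    rw [hqS, ← hdg]
    simp only [G, map_add, map_one, map_mul, map_star, map_sub]
    noncomm_ring
  obtain ⟨S, rfl⟩ := hS
  obtain ⟨G', hG'⟩ := hG
  refine exists_mem_extremePoints_closedBall_of_map_isUnit_mul_mul q (x := ↑S⁻¹ * x)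
    (y := y * ↑G'⁻¹) (S⁻¹.isUnit.mul hx) (hy.mul G'⁻¹.isUnit) hv
    (mul_star_mul_self_of_mul_mul_eq_zero
      (mem_extremePoints_closedBall_iff_mul_mul_eq_zero.mp hu)) ?_
  rw [← hG'] at hqa
  calc q (↑S⁻¹ * x * v * (y * ↑G'⁻¹)) = q ↑S⁻¹ * q a * q ↑G'⁻¹ := by
        rw [ha]; simp only [map_mul, mul_assoc]
    _ = q (↑S⁻¹ * S) * q a₀ * q (G' * ↑G'⁻¹) := by
        rw [hqa]; simp only [map_mul, mul_assoc]
    _ = q a₀ := by simp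

theorem exists_isUnit_mul_mul_map_eq_of_lift (q : A →⋆ₐ[ℂ] B) (hq : Function.Surjective q)
    (hlift : ∀ u ∈ Set.extremePoints ℝ (Metric.closedBall (0 : B) 1),
      ∃ v ∈ Set.extremePoints ℝ (Metric.closedBall (0 : A) 1), q v = u) {x u y : B}
    (hx : IsUnit x) (hy : IsUnit y)
    (hu : u ∈ Set.extremePoints ℝ (Metric.closedBall (0 : B) 1)) :
    ∃ X v Y : A, IsUnit X ∧ IsUnit Y ∧
      v ∈ Set.extremePoints ℝ (Metric.closedBall (0 : A) 1) ∧ q (X * v * Y) = x * u * y := by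
  obtain ⟨k, hk, s, hs, rfl⟩ := exists_isUnit_map_mul_unitary q hq hx
  obtain ⟨l, hl, t, ht, hyt⟩ := exists_isUnit_map_mul_unitary q hq hy.star
  obtain ⟨v, hv, hqv⟩ := hlift _ (unitary_mul_mul_mem_extremePoints_closedBall hs
    (Unitary.star_mem ht) hu)
  refine ⟨k, v, star l, hk, hl.star, hv, ?_⟩
  rw [← star_star y, hyt]
  simp only [map_mul, hqv, map_star, star_mul, mul_assoc]

theorem isOpenMap_of_surjective (q : A →⋆ₐ[ℂ] B) (hq : Function.Surjective q) : IsOpenMap q :=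
  ContinuousLinearMap.isOpenMap (⟨q.toAlgHom.toLinearMap, map_continuous q⟩ : A →L[ℂ] B) hq

theorem add_range_mem_closure_of_dense_isUnit {I A : Type*} [NonUnitalCStarAlgebra I]
    [CStarAlgebra A] (ι : I →⋆ₙₐ[ℂ] A)
    (hideal : ∀ (a : A) (x : I), a * ι x ∈ Set.range ι ∧ ι x * a ∈ Set.range ι)
    (hI : Dense {x : Unitization ℂ I | IsUnit x}) {v : A}
    (hv : v ∈ Set.extremePoints ℝ (Metric.closedBall (0 : A) 1)) (i : I) :
    v + ι i ∈ closure {a : A | ∃ x u y : A, IsUnit x ∧ IsUnit y ∧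
      u ∈ Set.extremePoints ℝ (Metric.closedBall (0 : A) 1) ∧ a = x * u * y} := by
  obtain ⟨z, hz⟩ := (hideal (star v) i).1
  let φ : Unitization ℂ I →⋆ₐ[ℂ] A := Unitization.starLift ι
  have hφ : Continuous φ := map_continuous φ
  have hφz : φ (1 + z) = 1 + star v * ι i := by
    rw [map_add, map_one, ← hz]
    exact congrArg (1 + ·) (DFunLike.congr_fun (Unitization.starLift.symm_apply_apply ι) z)
  let F : Unitization ℂ I → A := fun w => v * φ w + (1 - v * star v) * ι i
  have hF : Continuous F := by fun_prop
  have hFz : F (1 + z) = v + ι i := by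
    simp only [F, hφz]
    noncomm_ring
  rw [← hFz]
  refine map_mem_closure hF (hI (1 + (z : Unitization ℂ I))) fun w hw => ?_
  obtain ⟨d, hd, h⟩ := exists_mul_self_eq_zero_mul_add hv (ι i) ((show IsUnit w from hw).map φ)
  have hd1 : (1 + d) * (1 - d) = 1 := by
    calc (1 + d) * (1 - d) = 1 - d * d := by noncomm_ring
      _ = 1 := by rw [hd, sub_zero]
  have hd2 : (1 - d) * (1 + d) = 1 := by
    calc (1 - d) * (1 + d) = 1 - d * d := by noncomm_ring
      _ = 1 := by rw [hd, sub_zero]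
  exact ⟨1 + d, v, φ w, ⟨⟨1 + d, 1 - d, hd1, hd2⟩, rfl⟩, (show IsUnit w from hw).map φ, hv, h⟩

end ExtremallyRichLifting

/-- Let `I` be a C*-algebra of stable rank one, embedded (via the isometric
star homomorphism `ι`) as a closed two-sided ideal of a unital C*-algebra `A`, and let
`q : A → B` realize `B` as the quotient `A/I` (i.e. `q` is surjective with kernel the image
of `I`).  Then `A` is extremally rich if and only if `B` is extremally rich and every
extremal partial isometry (extreme point of the closed unit ball) of `B` lifts to an
extremal partial isometry of `A`. -/
theorem stmt0 {I A B : Type*} [NonUnitalCStarAlgebra I] [CStarAlgebra A] [CStarAlgebra B]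
    (ι : I →⋆ₙₐ[ℂ] A) (hιisom : Isometry ι)
    (hideal : ∀ (a : A) (x : I), a * ι x ∈ Set.range ι ∧ ι x * a ∈ Set.range ι)
    (q : A →⋆ₐ[ℂ] B) (hqsurj : Function.Surjective q)
    (hker : ∀ a : A, q a = 0 ↔ a ∈ Set.range ι)
    (hI : Dense {x : Unitization ℂ I | IsUnit x}) :
    ExtremallyRich A ↔
      (ExtremallyRich B ∧
        ∀ u ∈ Set.extremePoints ℝ (Metric.closedBall (0 : B) 1),
          ∃ v ∈ Set.extremePoints ℝ (Metric.closedBall (0 : A) 1), q v = u) := by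
  constructor
  · exact fun hA => ⟨hA.of_surjective q hqsurj,
      fun u hu => hA.exists_mem_extremePoints_closedBall_map_eq q hqsurj hu⟩
  · rintro ⟨hB, hlift⟩
    refine dense_closure.mp ((hB.preimage (isOpenMap_of_surjective q hqsurj)).mono ?_)
    rintro a ⟨x, u, y, hx, hy, hu, ha⟩
    obtain ⟨X, v, Y, ⟨X, rfl⟩, ⟨Y, rfl⟩, hv, hq⟩ :=
      exists_isUnit_mul_mul_map_eq_of_lift q hqsurj hlift hx hy hu
    obtain ⟨i, hi⟩ := (hker (a - X * v * Y)).mp (by rw [map_sub, ha, hq, sub_self])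
    obtain ⟨j, hj⟩ := (hideal (↑X⁻¹) i).1
    obtain ⟨k, hk⟩ := (hideal (↑Y⁻¹) j).2
    have hmem := add_range_mem_closure_of_dense_isUnit ι hideal hI hv k
    have hcont : Continuous fun b : A => X * b * Y := by fun_prop
    have hak : a = X * (v + ι k) * Y := by
      rw [hk, hj, hi]
      simp [mul_add, add_mul, mul_assoc]
    rw [hak]
    refine map_mem_closure (f := fun b : A => X * b * Y) hcont hmem ?_
    rintro _ ⟨x', u', y', hx', hy', hu', rfl⟩
    exact ⟨X * x', u', y' * Y, X.isUnit.mul hx', hy'.mul Y.isUnit, hu', by simp only [mul_assoc]⟩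
end

section
/- Let I be a closed two-sided ideal of a unital C*-algebra A such that both I and A/I have stable rank one. Then A is extremally rich if and only if every unitary in A/I lifts to an extremal partial isometry in A. -/
section

open Metric Set
open scoped CStarAlgebra

variable {A : Type*} [CStarAlgebra A]

lemma CStarAlgebra.isStarProjection_star_mul_self {v : A} (hv : v * star v * v = v) :
    IsStarProjection (star v * v) :=
  ⟨by rw [IsIdempotentElem, mul_assoc, ← mul_assoc v, hv], .star_mul_self v⟩

section Order

variable [PartialOrder A] [StarOrderedRing A]

lemma CStarAlgebra.star_mul_self_le_one_iff {x : A} : star x * x ≤ 1 ↔ ‖x‖ ≤ 1 := by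
  rw [← CStarAlgebra.norm_le_one_iff_of_nonneg (star x * x) (star_mul_self_nonneg x),
    CStarRing.norm_star_mul_self, ← sq, sq_le_one_iff₀ (norm_nonneg x)]

lemma CStarAlgebra.exists_unitary_mul_isStrictlyPositive {c : A} (hc : IsUnit c) :
    ∃ s ∈ unitary A, ∃ m : A, IsStrictlyPositive m ∧ c = s * m := by
  have hcc : IsUnit (star c * c) := hc.star.mul hc
  have hnn : 0 ≤ star c * c := star_mul_self_nonneg c
  set m := CFC.sqrt (star c * c) with hm
  have hmm : m * m = star c * c := CFC.sqrt_mul_sqrt_self _ hnn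
  have hm0 : 0 ≤ m := CFC.sqrt_nonneg _
  have hmu : IsUnit m := by
    rw [← hmm] at hcc
    exact isUnit_mul_self_iff.1 hcc
  have hsa : star m = m := hm0.isSelfAdjoint
  obtain ⟨n, hn⟩ := hmu
  have hnsa : star (↑n⁻¹ : A) = ↑n⁻¹ := by
    rw [← Units.coe_star_inv]
    congr 2
    ext
    simpa [hn] using hsa
  have hs1 : star (c * ↑n⁻¹) * (c * ↑n⁻¹) = 1 := by
    rw [star_mul, hnsa]
    calc (↑n⁻¹ : A) * star c * (c * ↑n⁻¹) = ↑n⁻¹ * (star c * c) * ↑n⁻¹ := by simp only [mul_assoc]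
      _ = ↑n⁻¹ * (n * n) * ↑n⁻¹ := by rw [← hmm, hn]
      _ = 1 := by simp
  have hsu : IsUnit (c * (↑n⁻¹ : A)) := hc.mul n⁻¹.isUnit
  refine ⟨c * ↑n⁻¹, ⟨hs1, ?_⟩, m, ?_, by simp [← hn, mul_assoc]⟩
  · obtain ⟨d, hd⟩ := hsu
    rw [← hd] at hs1 ⊢
    have : star (d : A) = ↑d⁻¹ := (Units.inv_eq_of_mul_eq_one_left hs1).symm
    simp [this]
  · exact (hn ▸ n.isUnit).isStrictlyPositive hm0

lemma eq_zero_of_mem_extremePoints_closedBall_s2 {E : Type*} [SeminormedAddCommGroup E]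
    [NormedSpace ℝ E] {x y : E} {r : ℝ} (hx : x ∈ extremePoints ℝ (closedBall (0 : E) r))
    (hadd : ‖x + y‖ ≤ r) (hsub : ‖x - y‖ ≤ r) : y = 0 := by
  have := hx.2 (x₁ := x + y) (x₂ := x - y) (by simpa using hadd) (by simpa using hsub)
    ⟨1 / 2, 1 / 2, by norm_num, by norm_num, by norm_num, by module⟩
  simpa using this

lemma CStarAlgebra.mul_star_mul_self_of_mem_extremePoints {x : A}
    (hx : x ∈ extremePoints ℝ (closedBall (0 : A) 1)) : x * star x * x = x := by
  have hx1 : ‖x‖ ≤ 1 := by simpa using hx.1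
  set c := star x * x with hc
  have hc1 : c ≤ 1 := star_mul_self_le_one_iff.2 hx1
  have hcn : ‖c‖ ≤ 1 := by
    rw [hc, CStarRing.norm_star_mul_self]
    exact mul_le_one₀ hx1 (norm_nonneg x) hx1
  have hcs : star c = c := (star_mul_self_nonneg x).isSelfAdjoint
  have hadd : ‖x * (3 - c)‖ ≤ 2 := by
    have h3 : star (3 - c) = 3 - c := by simp [hcs]
    have h14 : (1 : A) ≤ 4 := by simpa using Nat.mono_cast (α := A) (show 1 ≤ 4 by norm_num)
    have h4 : 0 ≤ 4 - c := sub_nonneg.2 (hc1.trans h14)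
    have h1 : star (1 - c) = 1 - c := by simp [hcs]
    have key : star (x * (3 - c)) * (x * (3 - c)) ≤ (4 : ℕ) := by
      rw [← sub_nonneg]
      calc (0 : A) ≤ star (1 - c) * (4 - c) * (1 - c) := star_left_conjugate_nonneg h4 _
        _ = (4 : ℕ) - (3 - c) * c * (3 - c) := by
          rw [h1, show (4 : A) = (4 : ℕ) by simp, ← nsmul_one]
          noncomm_ring
        _ = _ := by rw [star_mul, h3, hc]; simp only [mul_assoc]
    rw [← CStarAlgebra.norm_le_natCast_iff_of_nonneg _ 4 (star_mul_self_nonneg _),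
      CStarRing.norm_star_mul_self] at key
    push_cast at key
    nlinarith [norm_nonneg (x * (3 - c))]
  have hsub : ‖x + x * c‖ ≤ 2 := by
    refine (norm_add_le _ _).trans ?_
    have := (norm_mul_le x c).trans (mul_le_one₀ hx1 (norm_nonneg c) hcn)
    linarith
  have h := eq_zero_of_mem_extremePoints_closedBall_s2 hx (y := (1 / 2 : ℝ) • (x - x * c)) ?_ ?_
  · rw [smul_eq_zero_iff_right (by norm_num), sub_eq_zero] at h
    rw [mul_assoc, ← hc, ← h]
  · have : x + (1 / 2 : ℝ) • (x - x * c) = (1 / 2 : ℝ) • (x * (3 - c)) := by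
      have : x * 3 = x + x + x := by noncomm_ring
      rw [mul_sub, this]
      module
    rw [this, norm_smul]
    norm_num
    linarith
  · have : x - (1 / 2 : ℝ) • (x - x * c) = (1 / 2 : ℝ) • (x + x * c) := by module
    rw [this, norm_smul]
    norm_num
    linarith

lemma CStarAlgebra.one_sub_mul_mul_one_sub_of_mem_extremePoints {x : A}
    (hx : x ∈ extremePoints ℝ (closedBall (0 : A) 1)) (a : A) :
    (1 - x * star x) * a * (1 - star x * x) = 0 := by
  have hxx := mul_star_mul_self_of_mem_extremePoints hx
  have hp := (isStarProjection_star_mul_self hxx).one_sub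
  set z := (1 - x * star x) * a * (1 - star x * x) with hz
  have hxz : star x * z = 0 := by
    have : star x * (1 - x * star x) = 0 := by
      rw [mul_sub, mul_one, ← mul_assoc, sub_eq_zero]
      simpa [mul_assoc] using (congrArg star hxx).symm
    rw [hz, ← mul_assoc, ← mul_assoc, this, zero_mul, zero_mul]
  have hzp : z * (1 - star x * x) = z := by
    rw [hz, mul_assoc, hp.isIdempotentElem.eq]
  have key (w : A) (hw : ‖w‖ ≤ 1) (hxw : star x * w = 0) (hwp : w * (1 - star x * x) = w) :
      ‖x + w‖ ≤ 1 := by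
    rw [← star_mul_self_le_one_iff]
    have hwx : star w * x = 0 := by simpa using congrArg star hxw
    have h1 : star w * w ≤ 1 - star x * x := by
      have := star_left_conjugate_le_conjugate (star_mul_self_le_one_iff.2 hw) (1 - star x * x)
      rw [mul_one, hp.isSelfAdjoint.star_eq, hp.isIdempotentElem.eq] at this
      convert this using 1
      conv_lhs => rw [← hwp]
      rw [star_mul, hp.isSelfAdjoint.star_eq]
      simp only [mul_assoc]
    calc star (x + w) * (x + w) = star x * x + star w * w := by
          rw [star_add, add_mul, mul_add, mul_add, hxw, hwx, add_zero, zero_add]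
      _ ≤ star x * x + (1 - star x * x) := by gcongr
      _ = 1 := by abel
  have ht : (1 + ‖z‖)⁻¹ ≠ 0 := by positivity
  have hn : ‖(1 + ‖z‖)⁻¹ • z‖ ≤ 1 := by
    rw [norm_smul, norm_inv, Real.norm_of_nonneg (by positivity), inv_mul_le_one₀ (by positivity)]
    linarith
  have := eq_zero_of_mem_extremePoints_closedBall_s2 hx (y := (1 + ‖z‖)⁻¹ • z)
    (key _ hn (by rw [mul_smul_comm, hxz, smul_zero]) (by rw [smul_mul_assoc, hzp]))
    (by
      rw [sub_eq_add_neg]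
      exact key _ (by rwa [norm_neg]) (by rw [mul_neg, mul_smul_comm, hxz, smul_zero, neg_zero])
        (by rw [neg_mul, smul_mul_assoc, hzp]))
  rwa [smul_eq_zero_iff_right ht] at this

lemma CStarAlgebra.mem_extremePoints_of_mul_star_mul_self {v : A} (hv : v * star v * v = v)
    (h : ∀ a, (1 - v * star v) * a * (1 - star v * v) = 0) :
    v ∈ extremePoints ℝ (closedBall (0 : A) 1) := by
  have key (w a b : A) (hw : w * star w * w = w) (ha : ‖a‖ ≤ 1) (hb : ‖b‖ ≤ 1)
      (s t : ℝ) (hs : 0 < s) (ht : 0 < t) (hst : s + t = 1) (hab : s • a + t • b = w) :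
      (a - w) * (star w * w) = 0 := by
    have he := isStarProjection_star_mul_self hw
    have hsum : s • (star (a - w) * (a - w)) + t • (star (b - w) * (b - w))
        = s • (star a * a) + t • (star b * b) - star w * w := by
      obtain rfl : t = 1 - s := by linarith
      rw [← hab]
      simp only [star_sub, star_add, star_smul, mul_sub, sub_mul, mul_add, add_mul,
        smul_mul_assoc, mul_smul_comm, star_trivial]
      module
    have hle : s • (star (a - w) * (a - w)) ≤ 1 - star w * w := by
      calc s • (star (a - w) * (a - w))
          ≤ s • (star (a - w) * (a - w)) + t • (star (b - w) * (b - w)) :=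
            le_add_of_nonneg_right (smul_nonneg ht.le (star_mul_self_nonneg _))
        _ ≤ s • 1 + t • 1 - star w * w := by
            rw [hsum]
            gcongr <;> exact star_mul_self_le_one_iff.2 ‹_›
        _ = 1 - star w * w := by rw [← add_smul, hst, one_smul]
    have h2 := star_left_conjugate_le_conjugate hle (star w * w)
    rw [he.isSelfAdjoint.star_eq, mul_sub (star w * w) 1, mul_one, he.isIdempotentElem.eq, sub_self,
      zero_mul, mul_smul_comm, smul_mul_assoc] at h2
    have h3 : star ((a - w) * (star w * w)) * ((a - w) * (star w * w)) ≤ 0 := by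
      have := smul_le_smul_of_nonneg_left h2 (inv_nonneg.2 hs.le)
      rw [smul_smul, inv_mul_cancel₀ hs.ne', one_smul, smul_zero] at this
      rw [star_mul, he.isSelfAdjoint.star_eq]
      simpa only [mul_assoc] using this
    exact CStarRing.star_mul_self_eq_zero_iff _ |>.1 (h3.antisymm (star_mul_self_nonneg _))
  refine ⟨?_, ?_⟩
  · have := (isStarProjection_star_mul_self hv).norm_le
    rw [CStarRing.norm_star_mul_self] at this
    rw [mem_closedBall_zero_iff]
    nlinarith [norm_nonneg v]
  · rintro a ha b hb ⟨s, t, hs, ht, hst, hab⟩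
    rw [mem_closedBall_zero_iff] at ha hb
    have h1 := key v a b hv ha hb s t hs ht hst hab
    have h2 := key (star v) (star a) (star b) (by simpa [mul_assoc] using congrArg star hv)
      (by rwa [norm_star]) (by rwa [norm_star]) s t hs ht hst
      (by simpa using congrArg star hab)
    replace h2 : v * star v * (a - v) = 0 := by simpa [mul_assoc] using congrArg star h2
    have h3 := h (a - v)
    rw [sub_mul, one_mul, h2, sub_zero, mul_sub, mul_one, h1, sub_zero] at h3
    exact sub_eq_zero.1 h3

lemma CStarAlgebra.mem_extremePoints_closedBall_iff {v : A} :
    v ∈ extremePoints ℝ (closedBall (0 : A) 1) ↔ v * star v * v = v ∧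
      ∀ a, (1 - v * star v) * a * (1 - star v * v) = 0 :=
  ⟨fun h ↦ ⟨mul_star_mul_self_of_mem_extremePoints h,
    one_sub_mul_mul_one_sub_of_mem_extremePoints h⟩,
    fun h ↦ mem_extremePoints_of_mul_star_mul_self h.1 h.2⟩

lemma CStarAlgebra.mul_unitary_mem_extremePoints {v s : A}
    (hv : v ∈ extremePoints ℝ (closedBall (0 : A) 1)) (hs : s ∈ unitary A) :
    v * s ∈ extremePoints ℝ (closedBall (0 : A) 1) := by
  rw [mem_extremePoints_closedBall_iff] at hv ⊢
  have hss : s * star s = 1 := hs.2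
  have h1 : v * s * star (v * s) = v * star v := by
    rw [star_mul, mul_assoc, ← mul_assoc s, hss, one_mul]
  have h2 : 1 - star (v * s) * (v * s) = star s * (1 - star v * v) * s := by
    rw [star_mul, mul_sub, sub_mul, mul_one, hs.1]
    simp only [mul_assoc]
  refine ⟨by rw [h1, ← mul_assoc, hv.1], fun a ↦ ?_⟩
  rw [h1, h2, ← mul_assoc, ← mul_assoc, mul_assoc _ a, hv.2, zero_mul]

lemma CStarAlgebra.isStrictlyPositive_conj_add_one_sub {x v : A} (hx : IsUnit x)
    (hv : v * star v * v = v) :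
    IsStrictlyPositive (star (x * v) * (x * v) + (1 - star v * v)) := by
  have hp := (isStarProjection_star_mul_self hv).one_sub
  cases subsingleton_or_nontrivial A
  · exact ⟨(Subsingleton.elim _ _).le, isUnit_of_subsingleton _⟩
  obtain ⟨δ, hδ, hle⟩ := (CFC.exists_pos_algebraMap_le_iff (a := star x * x)
    (.star_mul_self x)).2 fun r hr ↦ by
      have hpos := (hx.star.mul hx).isStrictlyPositive (star_mul_self_nonneg x)
      exact hpos.spectrum_pos hr
  have hε : 0 < min δ 1 := by positivity
  have h1 : algebraMap ℝ A (min δ 1) ≤ star x * x :=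
    (algebraMap_le_algebraMap.2 (min_le_left _ _)).trans hle
  have h2 := star_left_conjugate_le_conjugate h1 v
  have h3 : min δ 1 • (1 - star v * v) ≤ 1 - star v * v := by
    simpa using smul_le_smul_of_nonneg_right (min_le_right δ 1) hp.nonneg
  refine .of_le (a := algebraMap ℝ A (min δ 1)) ?_ ?_
  · exact ((IsUnit.mk0 _ hε.ne').map (algebraMap ℝ A)).isStrictlyPositive
      (algebraMap_nonneg A hε.le)
  · calc algebraMap ℝ A (min δ 1)
        = star v * algebraMap ℝ A (min δ 1) * v + min δ 1 • (1 - star v * v) := by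
          rw [Algebra.algebraMap_eq_smul_one, mul_smul_comm, smul_mul_assoc, mul_one]
          module
      _ ≤ star v * (star x * x) * v + (1 - star v * v) := add_le_add h2 h3
      _ = _ := by rw [star_mul]; simp only [mul_assoc]

lemma CStarAlgebra.exists_mem_extremePoints_mul_isUnit {x v : A} (hx : IsUnit x)
    (hv : v ∈ extremePoints ℝ (closedBall (0 : A) 1)) :
    ∃ w ∈ extremePoints ℝ (closedBall (0 : A) 1), ∃ m : A, IsUnit m ∧ x * v = w * m := by
  obtain ⟨hvv, hvA⟩ := mem_extremePoints_closedBall_iff.1 hv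
  have hkpos := isStrictlyPositive_conj_add_one_sub hx hvv
  have hp := (isStarProjection_star_mul_self hvv).one_sub
  set p := 1 - star v * v with hpdef
  set k := star (x * v) * (x * v) + p with hk
  have hvp : v * p = 0 := by rw [hpdef, mul_sub, mul_one, ← mul_assoc, hvv, sub_self]
  have hkp : k * p = p := by
    rw [hk, add_mul, hp.isIdempotentElem.eq, mul_assoc, mul_assoc x, hvp, mul_zero, mul_zero,
      zero_add]
  have hmu := hkpos.isUnit_cfcSqrt
  have hmm := CFC.sqrt_mul_sqrt_self k hkpos.nonneg
  have hm0 := CFC.sqrt_nonneg k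
  have hmp : CFC.sqrt k * p = p := by
    have h1 : IsUnit (CFC.sqrt k + 1) := (IsStrictlyPositive.nonneg_add hm0 (by cfc_tac)).isUnit
    have h2 : (CFC.sqrt k + 1) * (CFC.sqrt k * p - p) = 0 := by
      rw [mul_sub, add_mul, ← mul_assoc, hmm, hkp]
      noncomm_ring
    exact sub_eq_zero.1 (h1.mul_right_eq_zero.1 h2)
  obtain ⟨m, hm⟩ := hmu
  rw [← hm] at hmm hm0 hmp
  have hnp : (↑m⁻¹ : A) * p = p := by rw [Units.inv_mul_eq_iff_eq_mul, hmp]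
  have hns : star (↑m⁻¹ : A) = ↑m⁻¹ := by
    rw [← Units.coe_star_inv]
    congr 2
    ext
    simpa using hm0.isSelfAdjoint.star_eq
  have hww : star (x * v * ↑m⁻¹) * (x * v * ↑m⁻¹) = star v * v := by
    calc star (x * v * ↑m⁻¹) * (x * v * ↑m⁻¹) = ↑m⁻¹ * (k - p) * ↑m⁻¹ := by
          rw [hk, add_sub_cancel_right, star_mul (x * v), hns]; simp only [mul_assoc]
      _ = ↑m⁻¹ * (m * m) * ↑m⁻¹ - star ↑m⁻¹ * p * ↑m⁻¹ := by rw [hmm, hns, mul_sub, sub_mul]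
      _ = 1 - p := by
          rw [hns, hnp]
          have : p * ↑m⁻¹ = p := by
            simpa [hns, hp.isSelfAdjoint.star_eq] using congrArg star hnp
          rw [this]
          simp
      _ = star v * v := by rw [hpdef]; abel
  have hw : x * v * ↑m⁻¹ * star (x * v * ↑m⁻¹) * (x * v * ↑m⁻¹) = x * v * ↑m⁻¹ := by
    rw [mul_assoc, hww, show star v * v = 1 - p by rw [hpdef]; abel, mul_sub, mul_one,
      mul_assoc _ _ p, hnp, mul_assoc x v p, hvp, mul_zero, sub_zero]
  refine ⟨x * v * ↑m⁻¹, mem_extremePoints_closedBall_iff.2 ⟨hw, fun a ↦ ?_⟩, m, m.isUnit,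
    by simp [mul_assoc]⟩
  rw [hww, ← hpdef]
  set r := 1 - x * v * ↑m⁻¹ * star (x * v * ↑m⁻¹) with hr
  have hrxv : r * (x * v) = 0 := by
    have : r * (x * v * ↑m⁻¹) = 0 := by rw [hr, sub_mul, one_mul, hw, sub_self]
    rw [← mul_assoc] at this
    exact (m⁻¹.isUnit.mul_left_eq_zero).1 this
  obtain ⟨y, rfl⟩ := hx
  calc r * a * p = r * (y * ((1 - v * star v) * (↑y⁻¹ * a) * p))
        + r * (y * v) * (star v * (↑y⁻¹ * a) * p) := by
        conv_lhs => rw [← one_mul a, ← y.mul_inv]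
        noncomm_ring
    _ = 0 := by rw [hrxv, hvA, mul_zero, mul_zero, zero_mul, add_zero]

end Order

lemma CStarAlgebra.norm_unitary_sub_one_lt_two {s h : A} (hs : s ∈ unitary A)
    (hsh : ‖h - s‖ < 1) [PartialOrder A] [StarOrderedRing A] (hh : 0 ≤ h) : ‖s - 1‖ < 2 := by
  rw [Unitary.norm_sub_one_lt_two_iff hs, spectrum.notMem_iff]
  have hK1 : 1 ≤ h + 1 := le_add_of_nonneg_left hh
  obtain ⟨K, hK⟩ : IsUnit (h + 1) := (IsStrictlyPositive.nonneg_add hh (by cfc_tac)).isUnit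
  rw [← hK] at hK1
  have hKinv : ‖(↑K⁻¹ : A)‖ ≤ 1 := by
    have h0 : (0 : A) ≤ ↑K⁻¹ := CFC.inv_nonneg_of_nonneg K (zero_le_one.trans hK1)
    exact (CStarAlgebra.norm_le_one_iff_of_nonneg _ h0).2 (CStarAlgebra.inv_le_one hK1)
  have hE : ‖↑K⁻¹ * (h - s)‖ < 1 :=
    (norm_mul_le _ _).trans_lt <| (mul_le_of_le_one_left (norm_nonneg _) hKinv).trans_lt hsh
  have h1 : algebraMap ℂ A (-1) - s = -(K * (1 - ↑K⁻¹ * (h - s))) := by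
    rw [mul_sub, ← mul_assoc, K.mul_inv, hK, map_neg, map_one]
    noncomm_ring
  rw [h1, IsUnit.neg_iff]
  exact K.isUnit.mul (isUnit_one_sub_of_norm_lt_one hE)

lemma CStarAlgebra.mem_unitary_of_isUnit {w : A} (hw : w * star w * w = w) (hu : IsUnit w) :
    w ∈ unitary A := by
  refine ⟨?_, hu.mul_right_cancel (by rw [hw, one_mul])⟩
  exact hu.mul_left_cancel (by rw [← mul_assoc, hw, mul_one])

section Surjective

variable {B : Type*} [CStarAlgebra B] {q : A →⋆ₐ[ℂ] B}

lemma StarAlgHom.exists_isSelfAdjoint_map_eq (hq : Function.Surjective q) {b : B}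
    (hb : IsSelfAdjoint b) : ∃ a, IsSelfAdjoint a ∧ q a = b := by
  obtain ⟨a, rfl⟩ := hq b
  refine ⟨realPart a, (realPart a).2, ?_⟩
  rw [realPart_apply_coe, ← Complex.coe_smul, map_smul, map_add, map_star, hb.star_eq,
    ← two_smul ℂ, smul_smul]
  simp

lemma StarAlgHom.exists_mem_unitary_map_eq (hq : Function.Surjective q) {s : B}
    (hs : s ∈ unitary B) (hs1 : ‖s - 1‖ < 2) : ∃ t ∈ unitary A, q t = s := by
  obtain ⟨k, hk, hqk⟩ := exists_isSelfAdjoint_map_eq hq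
    (Unitary.argSelfAdjoint (⟨s, hs⟩ : unitary B)).2
  refine ⟨selfAdjoint.expUnitary ⟨k, hk⟩, SetLike.coe_mem _, ?_⟩
  have := congrArg Subtype.val (expUnitary_argSelfAdjoint (u := ⟨s, hs⟩) hs1)
  rw [selfAdjoint.expUnitary_coe] at this ⊢
  let _ : NormedAlgebra ℚ A := NormedAlgebra.restrictScalars ℚ ℂ A
  let _ : NormedAlgebra ℚ B := NormedAlgebra.restrictScalars ℚ ℂ B
  rw [NormedSpace.map_exp q (map_continuous q), map_smul, hqk]
  exact this

lemma StarAlgHom.exists_isUnit_map_eq_of_isStrictlyPositive (hq : Function.Surjective q)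
    [PartialOrder B] [StarOrderedRing B] {m : B} (hm : IsStrictlyPositive m) :
    ∃ h : A, IsUnit h ∧ q h = m := by
  obtain ⟨l, hl⟩ := hq (CFC.log m)
  let _ : NormedAlgebra ℚ A := NormedAlgebra.restrictScalars ℚ ℂ A
  let _ : NormedAlgebra ℚ B := NormedAlgebra.restrictScalars ℚ ℂ B
  refine ⟨NormedSpace.exp l, NormedSpace.isUnit_exp l, ?_⟩
  rw [NormedSpace.map_exp q (map_continuous q), hl, CFC.exp_log m]

lemma ExtremallyRich.exists_mem_extremePoints_map_eq (hA : ExtremallyRich A)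
    (hq : Function.Surjective q) {u : B} (hu : u ∈ unitary B) :
    ∃ v ∈ extremePoints ℝ (closedBall (0 : A) 1), q v = u := by
  let _ := CStarAlgebra.spectralOrder A
  have _ := CStarAlgebra.spectralOrderedRing A
  let _ := CStarAlgebra.spectralOrder B
  have _ := CStarAlgebra.spectralOrderedRing B
  obtain ⟨a, ha⟩ := hq u
  obtain ⟨_, hz, ⟨x, v, y, hx, hy, hv, rfl⟩⟩ := Metric.dense_iff.1 hA a 1 one_pos
  obtain ⟨w, hw, m, hm, hxv⟩ := CStarAlgebra.exists_mem_extremePoints_mul_isUnit hx hv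
  obtain ⟨s, hs, h, hh, hmy⟩ :=
    CStarAlgebra.exists_unitary_mul_isStrictlyPositive (hm.mul hy)
  have hws := CStarAlgebra.mul_unitary_mem_extremePoints hw hs
  have hfac : x * v * y = w * s * h := by rw [hxv, mul_assoc, hmy, mul_assoc]
  set W := w * s
  have hnorm : ‖q W * q h - u‖ < 1 := by
    rw [← map_mul, ← ha, ← map_sub, ← hfac]
    exact (NonUnitalStarAlgHom.norm_apply_le q _).trans_lt (by rwa [← dist_eq_norm])
  have hWW : q W * star (q W) * q W = q W := by
    rw [← map_star, ← map_mul, ← map_mul,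
      CStarAlgebra.mul_star_mul_self_of_mem_extremePoints hws]
  have hqh : 0 ≤ q h := map_nonneg q hh.nonneg
  have hWu : q W ∈ unitary B := by
    refine CStarAlgebra.mem_unitary_of_isUnit hWW ?_
    have h1 : ‖star u * (u - q W * q h)‖ < 1 := by
      rwa [CStarRing.norm_mem_unitary_mul _ (Unitary.star_mem hu), norm_sub_rev]
    have h2 := (Unitary.isUnit_coe (U := ⟨u, hu⟩)).mul (isUnit_one_sub_of_norm_lt_one h1)
    rw [mul_sub, mul_one, ← mul_assoc, Unitary.mul_star_self_of_mem hu, one_mul,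
      sub_sub_cancel] at h2
    obtain ⟨k, hk⟩ := hh.isUnit.map q
    exact (Units.isUnit_mul_units (q W) k).1 (hk ▸ h2)
  have hWs := Unitary.star_mem hWu
  have hlt : ‖q h - star (q W) * u‖ < 1 := by
    rw [← CStarRing.norm_mem_unitary_mul _ hWu, mul_sub, ← mul_assoc,
      Unitary.mul_star_self_of_mem hWu, one_mul]
    exact hnorm
  have hWsu := mul_mem hWs hu
  obtain ⟨t, ht, hqt⟩ := StarAlgHom.exists_mem_unitary_map_eq hq hWsu
    (CStarAlgebra.norm_unitary_sub_one_lt_two hWsu hlt hqh)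
  refine ⟨W * t, CStarAlgebra.mul_unitary_mem_extremePoints hws ht, ?_⟩
  rw [map_mul, hqt, ← mul_assoc, Unitary.mul_star_self_of_mem hWu, one_mul]

lemma CStarAlgebra.exists_factorization_of_mem_extremePoints_of_isUnit {v z g : A}
    (hv : v ∈ extremePoints ℝ (closedBall (0 : A) 1)) (hg : IsUnit g) :
    ∃ x, IsUnit x ∧ v * g + (1 - v * star v) * z = x * v * g := by
  let _ := CStarAlgebra.spectralOrder A
  have _ := CStarAlgebra.spectralOrderedRing A
  obtain ⟨hvv, hvA⟩ := mem_extremePoints_closedBall_iff.1 hv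
  obtain ⟨g, rfl⟩ := hg
  set r := 1 - v * star v with hr
  have hrv : star v * r = 0 := by
    rw [hr, mul_sub, mul_one, ← mul_assoc, sub_eq_zero]
    simpa [mul_assoc] using (congrArg star hvv).symm
  have hsq : IsNilpotent (r * (z * ↑g⁻¹) * star v) := by
    refine ⟨2, ?_⟩
    rw [sq, mul_assoc, ← mul_assoc (star v), ← mul_assoc (star v), hrv]
    simp
  refine ⟨1 + r * (z * ↑g⁻¹) * star v, hsq.isUnit_one_add, ?_⟩
  have h := hvA (z * ↑g⁻¹)
  rw [mul_sub, mul_one, sub_eq_zero, ← mul_assoc _ (star v)] at h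
  rw [add_mul, add_mul, one_mul, ← h]
  simp [mul_assoc]

lemma mem_closure_extremallyRich_of_isUnit_map (hq : Function.Surjective q)
    (hlift : ∀ u ∈ unitary B, ∃ v ∈ extremePoints ℝ (closedBall (0 : A) 1), q v = u)
    (hker : ∀ z, q z = 0 → 1 + z ∈ closure {x : A | IsUnit x}) {a : A} (ha : IsUnit (q a)) :
    a ∈ closure {a : A | ∃ x u y : A, IsUnit x ∧ IsUnit y ∧
      u ∈ extremePoints ℝ (closedBall (0 : A) 1) ∧ a = x * u * y} := by
  let _ := CStarAlgebra.spectralOrder B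
  have _ := CStarAlgebra.spectralOrderedRing B
  obtain ⟨s, hs, m, hm, hsm⟩ := CStarAlgebra.exists_unitary_mul_isStrictlyPositive ha
  obtain ⟨_, ⟨h, rfl⟩, rfl⟩ := StarAlgHom.exists_isUnit_map_eq_of_isStrictlyPositive hq hm
  obtain ⟨v, hv, rfl⟩ := hlift s hs
  set z := a * ↑h⁻¹ - v with hz
  have hqz : q z = 0 := by
    rw [hz, map_sub, map_mul, hsm, mul_assoc, ← map_mul, h.mul_inv, map_one, mul_one, sub_self]
  have hsz : q (star v * z) = 0 := by rw [map_mul, hqz, mul_zero]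
  let φ : A → A := fun g ↦ (v * g + (1 - v * star v) * z) * h
  have hφ : φ (1 + star v * z) = a := by
    have : φ (1 + star v * z) = (v + z) * h := by simp only [φ]; noncomm_ring
    rw [this, hz, add_sub_cancel, mul_assoc, h.inv_mul, mul_one]
  rw [← hφ]
  refine map_mem_closure (by fun_prop) (hker _ hsz) fun g (hg : IsUnit g) ↦ ?_
  obtain ⟨x, hx, hfac⟩ :=
    CStarAlgebra.exists_factorization_of_mem_extremePoints_of_isUnit (z := z) hv hg
  exact ⟨x, v, g * h, hx, hg.mul h.isUnit, hv, by simp only [φ]; rw [hfac, mul_assoc]⟩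

lemma extremallyRich_of_forall_unitary (hq : Function.Surjective q)
    (hB : Dense {x : B | IsUnit x})
    (hlift : ∀ u ∈ unitary B, ∃ v ∈ extremePoints ℝ (closedBall (0 : A) 1), q v = u)
    (hker : ∀ z, q z = 0 → 1 + z ∈ closure {x : A | IsUnit x}) : ExtremallyRich A := by
  have hopen : IsOpenMap q :=
    ContinuousLinearMap.isOpenMap (⟨q.toAlgHom.toLinearMap, map_continuous q⟩ : A →L[ℂ] B) hq
  rw [ExtremallyRich, ← dense_closure]
  exact (hB.preimage hopen).mono fun a ha ↦
    mem_closure_extremallyRich_of_isUnit_map hq hlift hker ha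

end Surjective

lemma one_add_mem_closure_isUnit_of_unitization {I A : Type*} [NonUnitalCStarAlgebra I]
    [CStarAlgebra A] (ι : I →⋆ₙₐ[ℂ] A) (hI : Dense {x : Unitization ℂ I | IsUnit x}) (y : I) :
    1 + ι y ∈ closure {x : A | IsUnit x} := by
  let φ := Unitization.starLift ι
  have hφ : φ (1 + (y : Unitization ℂ I)) = 1 + ι y := by
    rw [map_add, map_one]
    rw [← Unitization.starLift_symm_apply_apply φ y, Equiv.symm_apply_apply]
  rw [← hφ]
  exact map_mem_closure (map_continuous φ) (hI _) fun g hg ↦ hg.map φ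

end

/-- Let `I` be a closed two-sided ideal of a unital C*-algebra `A`
(realized by the isometric embedding `ι : I → A`), and let `q : A → B` realize the quotient
`B = A/I`.  If both `I` and `B` have stable rank one, then `A` is extremally rich if and
only if every unitary in `A/I` lifts to an extremal partial isometry (extreme point of the
closed unit ball) in `A`. -/
theorem stmt2 {I A B : Type*} [NonUnitalCStarAlgebra I] [CStarAlgebra A] [CStarAlgebra B]
    (ι : I →⋆ₙₐ[ℂ] A) (hιisom : Isometry ι)
    (hideal : ∀ (a : A) (x : I), a * ι x ∈ Set.range ι ∧ ι x * a ∈ Set.range ι)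
    (q : A →⋆ₐ[ℂ] B) (hqsurj : Function.Surjective q)
    (hker : ∀ a : A, q a = 0 ↔ a ∈ Set.range ι)
    (hI : Dense {x : Unitization ℂ I | IsUnit x})
    (hB : Dense {x : B | IsUnit x}) :
    ExtremallyRich A ↔
      ∀ u ∈ unitary B,
        ∃ v ∈ Set.extremePoints ℝ (Metric.closedBall (0 : A) 1), q v = u := by
  refine ⟨fun hA u hu ↦ hA.exists_mem_extremePoints_map_eq hqsurj hu, fun hlift ↦
    extremallyRich_of_forall_unitary hqsurj hB hlift fun z hz ↦ ?_⟩
  obtain ⟨y, rfl⟩ := (hker z).1 hz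
  exact one_add_mem_closure_isUnit_of_unitization ι hI y
end
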